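/- For any two abelian finite-dimensional Lie superalgebras M and N over a field of characteristic ≠ 2, 3, there is an isomorphism (M ⊕ N) □ (M ⊕ N) ≅ (M □ M) ⊕ (N □ N) ⊕ (M ⊗ N). -/

import Mathlib

open Module Function TensorProduct

universe u v w x y z

/-- The sign `(-1)^(ab)` for degrees `a b : ZMod 2`, as an element of the field `F`. -/
def sgn (F : Type u) [Field F] (a b : ZMod 2) : F :=
  if a = 1 ∧ b = 1 then -1 else 1

/-- A supermodule (ℤ/2-graded vector space) over `F`. -/
class SuperModule (F : Type u) (V : Type v) [Field F] [AddCommGroup V] [Module F V] where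
  grade : ZMod 2 → Submodule F V
  isCompl_grade : IsCompl (grade 0) (grade 1)

/-- The graded piece of degree `a`. -/
abbrev gr (F : Type u) (V : Type v) [Field F] [AddCommGroup V] [Module F V]
    [s : SuperModule F V] (a : ZMod 2) : Submodule F V := s.grade a

/-- A Lie superalgebra structure on a supermodule. -/
class LieSuperAlgebra (F : Type u) (L : Type v) [Field F] [AddCommGroup L] [Module F L]
    [SuperModule F L] where
  bracket : L →ₗ[F] L →ₗ[F] L
  bracket_grade : ∀ (a b : ZMod 2) (x y : L), x ∈ gr F L a → y ∈ gr F L b →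
    bracket x y ∈ gr F L (a + b)
  skew : ∀ (a b : ZMod 2) (x y : L), x ∈ gr F L a → y ∈ gr F L b →
    bracket x y = -(sgn F a b) • bracket y x
  jacobi : ∀ (a b c : ZMod 2) (x y zz : L), x ∈ gr F L a → y ∈ gr F L b → zz ∈ gr F L c →
    sgn F a c • bracket x (bracket y zz) + sgn F b a • bracket y (bracket zz x)
      + sgn F c b • bracket zz (bracket x y) = 0

/-- The bracket of a Lie superalgebra. -/
abbrev br (F : Type u) (L : Type v) [Field F] [AddCommGroup L] [Module F L] [SuperModule F L]
    [s : LieSuperAlgebra F L] : L →ₗ[F] L →ₗ[F] L := s.bracket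

/-- A graded submodule. -/
def IsGradedSub (F : Type u) {V : Type v} [Field F] [AddCommGroup V] [Module F V]
    [SuperModule F V] (N : Submodule F V) : Prop :=
  N ≤ (N ⊓ gr F V 0) ⊔ (N ⊓ gr F V 1)

section LSADefs

variable (F : Type u) [Field F]
variable (L : Type v) [AddCommGroup L] [Module F L] [SuperModule F L] [LieSuperAlgebra F L]

/-- The derived subalgebra `L² = [L, L]`. -/
def derivedSub : Submodule F L := Submodule.span F {t | ∃ x y : L, br F L x y = t}

/-- The center `Z(L)`. -/
def centerSub : Submodule F L := ⨅ x : L, LinearMap.ker ((br F L).flip x)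

/-- The span of brackets `[A, B]` of two submodules. -/
def bracketSub (A B : Submodule F L) : Submodule F L :=
  Submodule.span F {t | ∃ x ∈ A, ∃ y ∈ B, br F L x y = t}

/-- Abelian Lie superalgebra. -/
def IsAbelianLSA : Prop := ∀ x y : L, br F L x y = 0

/-- The lower central series. -/
def lcs : ℕ → Submodule F L
  | 0 => ⊤
  | n + 1 => Submodule.span F {t | ∃ x : L, ∃ y ∈ lcs n, br F L x y = t}

/-- Nilpotent Lie superalgebra. -/
def IsNilpotentLSA : Prop := ∃ n : ℕ, lcs F L n = ⊥

end LSADefs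

/-- Homomorphism of Lie superalgebras: an even linear map preserving grading and bracket. -/
structure LieSuperHom (F : Type u) (L : Type v) (M : Type w) [Field F]
    [AddCommGroup L] [Module F L] [SuperModule F L] [LieSuperAlgebra F L]
    [AddCommGroup M] [Module F M] [SuperModule F M] [LieSuperAlgebra F M]
    extends L →ₗ[F] M where
  map_grade : ∀ (a : ZMod 2) (x : L), x ∈ gr F L a → toLinearMap x ∈ gr F M a
  map_bracket : ∀ x y : L, toLinearMap (br F L x y) = br F M (toLinearMap x) (toLinearMap y)

/-- Isomorphism of Lie superalgebras. -/
def LSAIsomorphic (F : Type u) (L : Type v) (M : Type w) [Field F]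
    [AddCommGroup L] [Module F L] [SuperModule F L] [LieSuperAlgebra F L]
    [AddCommGroup M] [Module F M] [SuperModule F M] [LieSuperAlgebra F M] : Prop :=
  ∃ f : LieSuperHom F L M, Function.Bijective f.toLinearMap

/-- `Q` is (a realization of) the quotient `L / L²`, i.e. the abelianization of `L`. -/
def IsQuotientByDerived (F : Type u) (L : Type v) (Q : Type w) [Field F]
    [AddCommGroup L] [Module F L] [SuperModule F L] [LieSuperAlgebra F L]
    [AddCommGroup Q] [Module F Q] [SuperModule F Q] [LieSuperAlgebra F Q] : Prop :=
  ∃ f : LieSuperHom F L Q, Function.Surjective f.toLinearMap ∧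
    LinearMap.ker f.toLinearMap = derivedSub F L

/-- An action of the Lie superalgebra `P` on the Lie superalgebra `M`. -/
structure LieSuperAction (F : Type u) (P : Type v) (M : Type w) [Field F]
    [AddCommGroup P] [Module F P] [SuperModule F P] [LieSuperAlgebra F P]
    [AddCommGroup M] [Module F M] [SuperModule F M] [LieSuperAlgebra F M] where
  act : P →ₗ[F] M →ₗ[F] M
  act_grade : ∀ (a b : ZMod 2) (p : P) (m : M), p ∈ gr F P a → m ∈ gr F M b →
    act p m ∈ gr F M (a + b)
  act_bracket : ∀ (a b : ZMod 2) (p p' : P) (m : M), p ∈ gr F P a → p' ∈ gr F P b →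
    act (br F P p p') m = act p (act p' m) - sgn F a b • act p' (act p m)
  act_lie : ∀ (a b : ZMod 2) (p : P) (m m' : M), p ∈ gr F P a → m ∈ gr F M b →
    act p (br F M m m') = br F M (act p m) m' + sgn F a b • br F M m (act p m')

/-- A trivial action. -/
def LieSuperAction.IsTrivial {F : Type u} {P : Type v} {M : Type w} [Field F]
    [AddCommGroup P] [Module F P] [SuperModule F P] [LieSuperAlgebra F P]
    [AddCommGroup M] [Module F M] [SuperModule F M] [LieSuperAlgebra F M]
    (α : LieSuperAction F P M) : Prop := ∀ (p : P) (m : M), α.act p m = 0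

/-- The trivial action of `P` on `M`. -/
def trivialAction (F : Type u) (P : Type v) (M : Type w) [Field F]
    [AddCommGroup P] [Module F P] [SuperModule F P] [LieSuperAlgebra F P]
    [AddCommGroup M] [Module F M] [SuperModule F M] [LieSuperAlgebra F M] :
    LieSuperAction F P M where
  act := 0
  act_grade := by
    intro a b p m _ _
    simp only [LinearMap.zero_apply]
    exact (gr F M (a + b)).zero_mem
  act_bracket := by intro a b p p' m _ _; simp
  act_lie := by intro a b p m m' _ _; simp

/-- A Lie superpairing on `M × N` (relative to mutual actions) with values in the
Lie superalgebra `T`; these are exactly the defining relations of the non-abelian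
tensor product `M ⊗ N`. -/
structure SuperPairing (F : Type u) (M : Type v) (N : Type w) (T : Type x) [Field F]
    [AddCommGroup M] [Module F M] [SuperModule F M] [LieSuperAlgebra F M]
    [AddCommGroup N] [Module F N] [SuperModule F N] [LieSuperAlgebra F N]
    [AddCommGroup T] [Module F T] [SuperModule F T] [LieSuperAlgebra F T]
    (α : LieSuperAction F M N) (β : LieSuperAction F N M) where
  pair : M →ₗ[F] N →ₗ[F] T
  pair_grade : ∀ (a b : ZMod 2) (m : M) (n : N), m ∈ gr F M a → n ∈ gr F N b →
    pair m n ∈ gr F T (a + b)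
  rel1 : ∀ (a b : ZMod 2) (m m' : M) (n : N), m ∈ gr F M a → m' ∈ gr F M b →
    pair (br F M m m') n = pair m (α.act m' n) - sgn F a b • pair m' (α.act m n)
  rel2 : ∀ (a b c : ZMod 2) (m : M) (n n' : N), m ∈ gr F M a → n ∈ gr F N b → n' ∈ gr F N c →
    pair m (br F N n n') = sgn F c (a + b) • pair (β.act n' m) n - sgn F a b • pair (β.act n m) n'
  rel3 : ∀ (a b : ZMod 2) (m : M) (n : N) (m' : M) (n' : N), m ∈ gr F M a → n ∈ gr F N b →
    br F T (pair m n) (pair m' n') = - sgn F a b • pair (β.act n m) (α.act m' n')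

/-- `T`, together with the pairing `p`, is (a realization of) the non-abelian tensor
product `M ⊗ N`: it satisfies the universal property among Lie superpairings. -/
def IsTensorProductLSA (F : Type u) (M : Type v) (N : Type w) (T : Type x) [Field F]
    [AddCommGroup M] [Module F M] [SuperModule F M] [LieSuperAlgebra F M]
    [AddCommGroup N] [Module F N] [SuperModule F N] [LieSuperAlgebra F N]
    [AddCommGroup T] [Module F T] [SuperModule F T] [LieSuperAlgebra F T]
    (α : LieSuperAction F M N) (β : LieSuperAction F N M)
    (p : SuperPairing F M N T α β) : Prop :=
  ∀ (T' : Type (max u v w x)) [AddCommGroup T'] [Module F T'] [SuperModule F T']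
    [LieSuperAlgebra F T'] (q : SuperPairing F M N T' α β),
    ∃! h : LieSuperHom F T T', ∀ (m : M) (n : N), h.toLinearMap (p.pair m n) = q.pair m n

/-- A Lie superpairing for the tensor square `L ⊗ L` (with adjoint actions):
the defining relations of the non-abelian tensor square. -/
structure TensorSqPairing (F : Type u) (L : Type v) (T : Type w) [Field F]
    [AddCommGroup L] [Module F L] [SuperModule F L] [LieSuperAlgebra F L]
    [AddCommGroup T] [Module F T] [SuperModule F T] [LieSuperAlgebra F T] where
  pair : L →ₗ[F] L →ₗ[F] T
  pair_grade : ∀ (a b : ZMod 2) (x y : L), x ∈ gr F L a → y ∈ gr F L b →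
    pair x y ∈ gr F T (a + b)
  rel1 : ∀ (a b : ZMod 2) (x x' y : L), x ∈ gr F L a → x' ∈ gr F L b →
    pair (br F L x x') y = pair x (br F L x' y) - sgn F a b • pair x' (br F L x y)
  rel2 : ∀ (a b c : ZMod 2) (x y y' : L), x ∈ gr F L a → y ∈ gr F L b → y' ∈ gr F L c →
    pair x (br F L y y') = sgn F c (a + b) • pair (br F L y' x) y
      - sgn F a b • pair (br F L y x) y'
  rel3 : ∀ (a b : ZMod 2) (x y x' y' : L), x ∈ gr F L a → y ∈ gr F L b →
    br F T (pair x y) (pair x' y') = - sgn F a b • pair (br F L y x) (br F L x' y')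

/-- `T`, together with the pairing `p`, is (a realization of) the non-abelian tensor
square `L ⊗ L`. -/
def IsTensorSquare (F : Type u) (L : Type v) (T : Type w) [Field F]
    [AddCommGroup L] [Module F L] [SuperModule F L] [LieSuperAlgebra F L]
    [AddCommGroup T] [Module F T] [SuperModule F T] [LieSuperAlgebra F T]
    (p : TensorSqPairing F L T) : Prop :=
  ∀ (T' : Type (max u v w)) [AddCommGroup T'] [Module F T'] [SuperModule F T']
    [LieSuperAlgebra F T'] (q : TensorSqPairing F L T'),
    ∃! h : LieSuperHom F T T', ∀ x y : L, h.toLinearMap (p.pair x y) = q.pair x y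

/-- The submodule `L □ L` of a realization `T` of `L ⊗ L`, generated by the elements
`x ⊗ x' + (-1)^{|x||x'|} (x' ⊗ x)` (homogeneous `x, x'`) and `x₀ ⊗ x₀` (`x₀` even). -/
def squareBox (F : Type u) (L : Type v) (T : Type w) [Field F]
    [AddCommGroup L] [Module F L] [SuperModule F L] [LieSuperAlgebra F L]
    [AddCommGroup T] [Module F T] [SuperModule F T] [LieSuperAlgebra F T]
    (p : TensorSqPairing F L T) : Submodule F T :=
  Submodule.span F
    ({t | ∃ (a b : ZMod 2) (x y : L), x ∈ gr F L a ∧ y ∈ gr F L b ∧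
        t = p.pair x y + sgn F a b • p.pair y x} ∪
      {t | ∃ x ∈ gr F L 0, t = p.pair x x})

/-- Data of a "universal quadratic functor" target: maps satisfying the defining
relations of `Γ(V)`. -/
structure GammaData (F : Type u) (V : Type v) (W : Type w) [Field F]
    [AddCommGroup V] [Module F V] [SuperModule F V] [AddCommGroup W] [Module F W] where
  gam : V → W
  bil : V →ₗ[F] V →ₗ[F] W
  gam_smul : ∀ (c : F) (v : V), v ∈ gr F V 0 → gam (c • v) = (c * c) • gam v
  gam_add : ∀ v w' : V, v ∈ gr F V 0 → w' ∈ gr F V 0 →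
    gam (v + w') - gam v - gam w' = bil v w'
  bil_symm : ∀ (a b : ZMod 2) (v w' : V), v ∈ gr F V a → w' ∈ gr F V b →
    bil v w' = sgn F a b • bil w' v
  bil_alt : ∀ v : V, v ∈ gr F V 1 → bil v v = 0

/-- `W`, with data `d`, is (a realization of) the universal quadratic functor `Γ(V)`. -/
def IsGamma (F : Type u) (V : Type v) (W : Type w) [Field F]
    [AddCommGroup V] [Module F V] [SuperModule F V] [AddCommGroup W] [Module F W]
    (d : GammaData F V W) : Prop :=
  ∀ (W' : Type (max u v w)) [AddCommGroup W'] [Module F W'] (d' : GammaData F V W'),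
    ∃! h : W →ₗ[F] W',
      (∀ v ∈ gr F V 0, h (d.gam v) = d'.gam v) ∧ (∀ v w' : V, h (d.bil v w') = d'.bil v w')

/-- `Fr` is a free Lie superalgebra on the graded set `(X, deg)` with inclusion `ι`. -/
def IsFreeLSA (F : Type u) (X : Type v) (deg : X → ZMod 2) (Fr : Type w) [Field F]
    [AddCommGroup Fr] [Module F Fr] [SuperModule F Fr] [LieSuperAlgebra F Fr]
    (ι : X → Fr) : Prop :=
  (∀ x : X, ι x ∈ gr F Fr (deg x)) ∧
  ∀ (K : Type (max u v w)) [AddCommGroup K] [Module F K] [SuperModule F K]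
    [LieSuperAlgebra F K] (f : X → K), (∀ x : X, f x ∈ gr F K (deg x)) →
    ∃! h : LieSuperHom F Fr K, ∀ x : X, h.toLinearMap (ι x) = f x

/-- Dimension of the degree-`a` part of the Schur multiplier `(R ∩ [Fr,Fr])/[Fr,R]`
attached to a free presentation with kernel `R`. -/
noncomputable def schurDim (F : Type u) (Fr : Type v) [Field F] [AddCommGroup Fr]
    [Module F Fr] [SuperModule F Fr] [LieSuperAlgebra F Fr]
    (R : Submodule F Fr) (a : ZMod 2) : ℕ :=
  finrank F ((R ⊓ derivedSub F Fr ⊓ gr F Fr a).map (bracketSub F Fr ⊤ R).mkQ)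

/-- `L` is (isomorphic to) the Heisenberg Lie superalgebra `H(m, n)` with even center:
it admits a homogeneous basis `x₁,…,x_{2m}, y₁,…,y_n, z` with the defining brackets. -/
def IsHmn (F : Type u) (m n : ℕ) (L : Type v) [Field F]
    [AddCommGroup L] [Module F L] [SuperModule F L] [LieSuperAlgebra F L] : Prop :=
  ∃ (xv : Fin (2 * m) → L) (yv : Fin n → L) (zv : L)
    (B : Basis ((Fin (2 * m)) ⊕ (Fin n) ⊕ Unit) F L),
    (∀ i, B (Sum.inl i) = xv i) ∧ (∀ j, B (Sum.inr (Sum.inl j)) = yv j) ∧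
    B (Sum.inr (Sum.inr ())) = zv ∧
    (∀ i, xv i ∈ gr F L 0) ∧ (∀ j, yv j ∈ gr F L 1) ∧ zv ∈ gr F L 0 ∧
    (∀ i j : Fin (2 * m), br F L (xv i) (xv j) =
      if (j : ℕ) = (i : ℕ) + m then zv else if (i : ℕ) = (j : ℕ) + m then -zv else 0) ∧
    (∀ (i : Fin (2 * m)) (j : Fin n), br F L (xv i) (yv j) = 0) ∧
    (∀ (j : Fin n) (i : Fin (2 * m)), br F L (yv j) (xv i) = 0) ∧
    (∀ j k : Fin n, br F L (yv j) (yv k) = if j = k then zv else 0) ∧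
    (∀ i, br F L (xv i) zv = 0) ∧ (∀ i, br F L zv (xv i) = 0) ∧
    (∀ j, br F L (yv j) zv = 0) ∧ (∀ j, br F L zv (yv j) = 0) ∧
    br F L zv zv = 0

/-- `L` is (isomorphic to) the Heisenberg Lie superalgebra `H_m` with odd center. -/
def IsHmOdd (F : Type u) (m : ℕ) (L : Type v) [Field F]
    [AddCommGroup L] [Module F L] [SuperModule F L] [LieSuperAlgebra F L] : Prop :=
  ∃ (xv yv : Fin m → L) (zv : L) (B : Basis ((Fin m) ⊕ (Fin m) ⊕ Unit) F L),
    (∀ i, B (Sum.inl i) = xv i) ∧ (∀ j, B (Sum.inr (Sum.inl j)) = yv j) ∧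
    B (Sum.inr (Sum.inr ())) = zv ∧
    (∀ i, xv i ∈ gr F L 0) ∧ (∀ j, yv j ∈ gr F L 1) ∧ zv ∈ gr F L 1 ∧
    (∀ i j, br F L (xv i) (xv j) = 0) ∧
    (∀ i j, br F L (xv i) (yv j) = if i = j then zv else 0) ∧
    (∀ i j, br F L (yv i) (xv j) = if i = j then -zv else 0) ∧
    (∀ i j, br F L (yv i) (yv j) = 0) ∧
    (∀ i, br F L (xv i) zv = 0) ∧ (∀ i, br F L zv (xv i) = 0) ∧
    (∀ j, br F L (yv j) zv = 0) ∧ (∀ j, br F L zv (yv j) = 0) ∧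
    br F L zv zv = 0

/-- `A` is (isomorphic to) the abelian Lie superalgebra `A(a | b)`. -/
def IsAbelianOfDim (F : Type u) (a b : ℕ) (A : Type v) [Field F]
    [AddCommGroup A] [Module F A] [SuperModule F A] [LieSuperAlgebra F A] : Prop :=
  IsAbelianLSA F A ∧ finrank F (gr F A 0) = a ∧ finrank F (gr F A 1) = b

/-- Heisenberg Lie superalgebra with even center: `Z(L) = L²` is one-dimensional,
spanned by a nonzero even element. -/
def IsHeisenbergEven (F : Type u) (L : Type v) [Field F]
    [AddCommGroup L] [Module F L] [SuperModule F L] [LieSuperAlgebra F L] : Prop :=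
  centerSub F L = derivedSub F L ∧
  ∃ zc : L, zc ≠ 0 ∧ zc ∈ gr F L 0 ∧ centerSub F L = Submodule.span F {zc}

/-- Heisenberg Lie superalgebra with odd center. -/
def IsHeisenbergOdd (F : Type u) (L : Type v) [Field F]
    [AddCommGroup L] [Module F L] [SuperModule F L] [LieSuperAlgebra F L] : Prop :=
  centerSub F L = derivedSub F L ∧
  ∃ zc : L, zc ≠ 0 ∧ zc ∈ gr F L 1 ∧ centerSub F L = Submodule.span F {zc}

/-- `P ≅ L ⊕ M` as Lie superalgebras (internal direct sum of two commuting copies). -/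
def IsDirectSumOf (F : Type u) (P : Type v) (L : Type w) (M : Type x) [Field F]
    [AddCommGroup P] [Module F P] [SuperModule F P] [LieSuperAlgebra F P]
    [AddCommGroup L] [Module F L] [SuperModule F L] [LieSuperAlgebra F L]
    [AddCommGroup M] [Module F M] [SuperModule F M] [LieSuperAlgebra F M] : Prop :=
  ∃ (f : LieSuperHom F L P) (g : LieSuperHom F M P),
    Function.Bijective (fun q : L × M => f.toLinearMap q.1 + g.toLinearMap q.2) ∧
    (∀ (x : L) (y : M), br F P (f.toLinearMap x) (g.toLinearMap y) = 0) ∧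
    (∀ (y : M) (x : L), br F P (g.toLinearMap y) (f.toLinearMap x) = 0)

/-- `S ≅ A ⊕ B ⊕ C ⊕ D` as Lie superalgebras. -/
def IsDirectSumOf4 (F : Type u) (S : Type v) (A : Type w) (B : Type x) (C : Type y)
    (D : Type z) [Field F]
    [AddCommGroup S] [Module F S] [SuperModule F S] [LieSuperAlgebra F S]
    [AddCommGroup A] [Module F A] [SuperModule F A] [LieSuperAlgebra F A]
    [AddCommGroup B] [Module F B] [SuperModule F B] [LieSuperAlgebra F B]
    [AddCommGroup C] [Module F C] [SuperModule F C] [LieSuperAlgebra F C]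
    [AddCommGroup D] [Module F D] [SuperModule F D] [LieSuperAlgebra F D] : Prop :=
  ∃ (f : LieSuperHom F A S) (g : LieSuperHom F B S) (h : LieSuperHom F C S)
    (k : LieSuperHom F D S),
    Function.Bijective (fun q : A × B × C × D =>
      f.toLinearMap q.1 + g.toLinearMap q.2.1 + h.toLinearMap q.2.2.1
        + k.toLinearMap q.2.2.2) ∧
    (∀ u v', br F S (f.toLinearMap u) (g.toLinearMap v') = 0) ∧
    (∀ u v', br F S (f.toLinearMap u) (h.toLinearMap v') = 0) ∧
    (∀ u v', br F S (f.toLinearMap u) (k.toLinearMap v') = 0) ∧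
    (∀ u v', br F S (g.toLinearMap u) (h.toLinearMap v') = 0) ∧
    (∀ u v', br F S (g.toLinearMap u) (k.toLinearMap v') = 0) ∧
    (∀ u v', br F S (h.toLinearMap u) (k.toLinearMap v') = 0)

/-- `L ≅ H(m, n) ⊕ A(a | b)`: an internal decomposition into a Heisenberg part with
even center, spanned by homogeneous elements with the defining brackets, and a central
abelian graded complement of dimension `(a | b)`. -/
def DecompHeisenbergAbelian (F : Type u) (L : Type v) [Field F]
    [AddCommGroup L] [Module F L] [SuperModule F L] [LieSuperAlgebra F L]
    (m n a b : ℕ) : Prop :=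
  ∃ (xv : Fin (2 * m) → L) (yv : Fin n → L) (zv : L) (A : Submodule F L),
    (∀ i, xv i ∈ gr F L 0) ∧ (∀ j, yv j ∈ gr F L 1) ∧ zv ∈ gr F L 0 ∧
    IsGradedSub F A ∧
    finrank F (A ⊓ gr F L 0 : Submodule F L) = a ∧
    finrank F (A ⊓ gr F L 1 : Submodule F L) = b ∧
    (∀ u ∈ A, ∀ v : L, br F L u v = 0 ∧ br F L v u = 0) ∧
    LinearIndependent F (Sum.elim xv (Sum.elim yv (fun _ : Unit => zv))) ∧
    Disjoint (Submodule.span F (Set.range (Sum.elim xv (Sum.elim yv (fun _ : Unit => zv))))) A ∧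
    Submodule.span F (Set.range (Sum.elim xv (Sum.elim yv (fun _ : Unit => zv)))) ⊔ A = ⊤ ∧
    (∀ i j : Fin (2 * m), br F L (xv i) (xv j) =
      if (j : ℕ) = (i : ℕ) + m then zv else if (i : ℕ) = (j : ℕ) + m then -zv else 0) ∧
    (∀ (i : Fin (2 * m)) (j : Fin n), br F L (xv i) (yv j) = 0) ∧
    (∀ (j : Fin n) (i : Fin (2 * m)), br F L (yv j) (xv i) = 0) ∧
    (∀ j k : Fin n, br F L (yv j) (yv k) = if j = k then zv else 0) ∧
    (∀ i, br F L (xv i) zv = 0) ∧ (∀ i, br F L zv (xv i) = 0) ∧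
    (∀ j, br F L (yv j) zv = 0) ∧ (∀ j, br F L zv (yv j) = 0) ∧
    br F L zv zv = 0

/-- The submodule of a realization of `I ⊗ J` (for graded ideals `I, J` of `M`)
generated by `x ⊗ y + (-1)^(|x||y|) y ⊗ x` and `x₀ ⊗ x₀` for `x, y, x₀ ∈ I ∩ J`,
`x₀` even. -/
def pairBox (F : Type u) (I : Type v) (J : Type w) (TIJ : Type x) (M : Type y) [Field F]
    [AddCommGroup I] [Module F I] [SuperModule F I] [LieSuperAlgebra F I]
    [AddCommGroup J] [Module F J] [SuperModule F J] [LieSuperAlgebra F J]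
    [AddCommGroup TIJ] [Module F TIJ] [SuperModule F TIJ] [LieSuperAlgebra F TIJ]
    [AddCommGroup M] [Module F M] [SuperModule F M] [LieSuperAlgebra F M]
    (ι : LieSuperHom F I M) (κ : LieSuperHom F J M)
    (α : LieSuperAction F I J) (β : LieSuperAction F J I)
    (p : SuperPairing F I J TIJ α β) : Submodule F TIJ :=
  Submodule.span F
    ({t | ∃ (a b : ZMod 2) (i i' : I) (j j' : J),
        ι.toLinearMap i = κ.toLinearMap j ∧ ι.toLinearMap i' = κ.toLinearMap j' ∧
        ι.toLinearMap i ∈ gr F M a ∧ ι.toLinearMap i' ∈ gr F M b ∧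
        t = p.pair i j' + sgn F a b • p.pair i' j} ∪
      {t | ∃ (i : I) (j : J), ι.toLinearMap i = κ.toLinearMap j ∧
        ι.toLinearMap i ∈ gr F M 0 ∧ t = p.pair i j})


section Helpers

variable {F : Type u} [Field F]

lemma zmod2_cases (a : ZMod 2) : a = 0 ∨ a = 1 := by
  revert a; decide

lemma gr_decomp {L : Type v} [AddCommGroup L] [Module F L] [SuperModule F L] (x : L) :
    ∃ x0 ∈ gr F L 0, ∃ x1 ∈ gr F L 1, x = x0 + x1 := by
  have h : x ∈ gr F L 0 ⊔ gr F L 1 := by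
    rw [(SuperModule.isCompl_grade (F := F) (V := L)).sup_eq_top]; trivial
  obtain ⟨y, hy, z, hz, h⟩ := Submodule.mem_sup.1 h
  exact ⟨y, hy, z, hz, h.symm⟩

lemma exists_oddProj (F : Type u) [Field F] (L : Type v) [AddCommGroup L] [Module F L]
    [SuperModule F L] :
    ∃ π : L →ₗ[F] L, (∀ x ∈ gr F L 0, π x = 0) ∧ (∀ x ∈ gr F L 1, π x = x) := by
  have hc := (SuperModule.isCompl_grade (F := F) (V := L)).symm
  refine ⟨(gr F L 1).subtype ∘ₗ Submodule.projectionOnto _ _ hc, ?_, ?_⟩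
  · intro x hx
    have := (Submodule.projectionOnto_apply_eq_zero_iff hc).2 hx
    rw [LinearMap.comp_apply, this, map_zero]
  · intro x hx
    have := Submodule.projectionOnto_apply_left hc ⟨x, hx⟩
    exact congrArg Subtype.val this

/-- Grading from an idempotent (projection on the even part). -/
def superOfIdem {V : Type v} [AddCommGroup V] [Module F V] (q : V →ₗ[F] V)
    (hq : ∀ x, q (q x) = q x) : SuperModule F V where
  grade a := if a = 0 then LinearMap.ker (LinearMap.id - q) else LinearMap.ker q
  isCompl_grade := by
    simp only [if_true, one_ne_zero, if_false]
    rw [isCompl_iff, disjoint_iff, codisjoint_iff]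
    constructor
    · rw [eq_bot_iff]
      rintro x ⟨h1, h2⟩
      simp only [SetLike.mem_coe, LinearMap.mem_ker, LinearMap.sub_apply, LinearMap.id_apply]
        at h1 h2
      rw [h2, sub_zero] at h1
      exact h1
    · rw [eq_top_iff]
      intro x _
      refine Submodule.mem_sup.2 ⟨q x, ?_, x - q x, ?_, by abel⟩
      · simp [hq]
      · simp [hq]

/-- Transport of grading. -/
def superComap {V : Type v} {V' : Type w} [AddCommGroup V] [Module F V] [AddCommGroup V']
    [Module F V'] [SuperModule F V] (e : V' ≃ₗ[F] V) : SuperModule F V' where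
  grade a := (gr F V a).comap e.toLinearMap
  isCompl_grade := by
    have h := SuperModule.isCompl_grade (F := F) (V := V)
    exact (Submodule.orderIsoMapComap e).symm.isCompl h

/-- Transport of Lie superalgebra structure. -/
def lsaComap {V : Type v} {V' : Type w} [AddCommGroup V] [Module F V] [AddCommGroup V']
    [Module F V'] [SuperModule F V] [LieSuperAlgebra F V] (e : V' ≃ₗ[F] V) :
    @LieSuperAlgebra F V' _ _ _ (superComap e) :=
  letI := superComap e
  { bracket := ((br F V).compl₁₂ e.toLinearMap e.toLinearMap).compr₂ e.symm.toLinearMap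
    bracket_grade := by
      intro a b x y hx hy
      change e (e.symm _) ∈ gr F V (a + b)
      rw [e.apply_symm_apply]
      exact LieSuperAlgebra.bracket_grade a b _ _ hx hy
    skew := by
      intro a b x y hx hy
      have := LieSuperAlgebra.skew (F := F) (L := V) a b _ _ hx hy
      apply e.injective
      simpa using this
    jacobi := by
      intro a b c x y z hx hy hz
      have := LieSuperAlgebra.jacobi (F := F) (L := V) a b c _ _ _ hx hy hz
      apply e.injective
      simpa using this }

/-- The abelian structure. -/
def lsaZero (F : Type u) [Field F] (V : Type v) [AddCommGroup V] [Module F V]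
    [SuperModule F V] : LieSuperAlgebra F V where
  bracket := 0
  bracket_grade := by intros; simp
  skew := by intros; simp
  jacobi := by intros; simp

lemma sum_mul_tensor_grade {M : Type v} {N : Type w} [AddCommGroup M] [Module F M]
    [SuperModule F M] [AddCommGroup N] [Module F N] [SuperModule F N] :
    ∃ s : SuperModule F (M ⊗[F] N), ∀ (a b : ZMod 2) (m : M) (n : N), m ∈ gr F M a →
      n ∈ gr F N b → m ⊗ₜ[F] n ∈ s.grade (a + b) := by
  obtain ⟨π, h0, h1⟩ := exists_oddProj F M
  obtain ⟨ρ, k0, k1⟩ := exists_oddProj F N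
  have hπ : ∀ x, π (π x) = π x := by
    intro x
    obtain ⟨y, hy, z, hz, rfl⟩ := gr_decomp (F := F) x
    simp [h0 y hy, h1 z hz]
  have hρ : ∀ x, ρ (ρ x) = ρ x := by
    intro x
    obtain ⟨y, hy, z, hz, rfl⟩ := gr_decomp (F := F) x
    simp [k0 y hy, k1 z hz]
  let q : M ⊗[F] N →ₗ[F] M ⊗[F] N :=
    TensorProduct.map (LinearMap.id - π) (LinearMap.id - ρ) + TensorProduct.map π ρ
  have hq : ∀ x, q (q x) = q x := by
    intro x
    have : q ∘ₗ q = q := by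
      apply TensorProduct.ext'
      intro x y
      simp [q, hπ, hρ]
    exact LinearMap.congr_fun this x
  refine ⟨superOfIdem q hq, ?_⟩
  intro a b m n hm hn
  rcases zmod2_cases a with rfl | rfl <;> rcases zmod2_cases b with rfl | rfl
  · change m ⊗ₜ[F] n ∈ LinearMap.ker (LinearMap.id - q)
    simp [q, h0 m hm, k0 n hn]
  · change m ⊗ₜ[F] n ∈ LinearMap.ker q
    simp [q, h0 m hm, k1 n hn]
  · change m ⊗ₜ[F] n ∈ LinearMap.ker q
    simp [q, h1 m hm, k0 n hn]
  · change m ⊗ₜ[F] n ∈ LinearMap.ker (LinearMap.id - q)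
    simp [q, h1 m hm, k1 n hn]

lemma core {M : Type v} {N : Type w} {T : Type x} [AddCommGroup M] [Module F M]
    [SuperModule F M] [AddCommGroup N] [Module F N] [SuperModule F N]
    [AddCommGroup T] [Module F T] [SuperModule F T] [LieSuperAlgebra F T]
    (p : M →ₗ[F] N →ₗ[F] T)
    (hg : ∀ (a b : ZMod 2) (m : M) (n : N), m ∈ gr F M a → n ∈ gr F N b →
      p m n ∈ gr F T (a + b))
    (hb : ∀ m n m' n', br F T (p m n) (p m' n') = 0)
    (hu : ∀ (T' : Type (max u v w x)) [AddCommGroup T'] [Module F T'] [SuperModule F T']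
      [LieSuperAlgebra F T'] (q : M →ₗ[F] N →ₗ[F] T')
      (_ : ∀ (a b : ZMod 2) (m : M) (n : N), m ∈ gr F M a → n ∈ gr F N b →
        q m n ∈ gr F T' (a + b))
      (_ : ∀ m n m' n', br F T' (q m n) (q m' n') = 0),
      ∃! h : LieSuperHom F T T', ∀ (m : M) (n : N), h.toLinearMap (p m n) = q m n) :
    ∃ e : T ≃ₗ[F] M ⊗[F] N, ∀ m n, e (p m n) = m ⊗ₜ n := by
  obtain ⟨s, hs⟩ := sum_mul_tensor_grade (F := F) (M := M) (N := N)
  let g : M ⊗[F] N →ₗ[F] T := TensorProduct.lift p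
  have hgb : ∀ t t', br F T (g t) (g t') = 0 := by
    intro t t'
    induction t using TensorProduct.induction_on with
    | zero => simp
    | add a b ha hb => simp [ha, hb]
    | tmul m n =>
      induction t' using TensorProduct.induction_on with
      | zero => simp
      | add a b ha hb => simp [ha, hb]
      | tmul m' n' => simpa [g] using hb m n m' n'
  have hgg : ∀ a, ∀ t ∈ s.grade a, g t ∈ gr F T a := by
    have hd : ∀ t, ∃ t0 ∈ s.grade 0, ∃ t1 ∈ s.grade 1, t = t0 + t1 ∧ g t0 ∈ gr F T 0 ∧
        g t1 ∈ gr F T 1 := by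
      intro t
      induction t using TensorProduct.induction_on with
      | zero => exact ⟨0, zero_mem _, 0, zero_mem _, by simp, by simp, by simp⟩
      | add a b ha hb =>
        obtain ⟨a0, h1, a1, h2, rfl, h3, h4⟩ := ha
        obtain ⟨b0, k1, b1, k2, rfl, k3, k4⟩ := hb
        refine ⟨a0 + b0, add_mem h1 k1, a1 + b1, add_mem h2 k2, by abel, ?_, ?_⟩
        · rw [map_add]; exact add_mem h3 k3
        · rw [map_add]; exact add_mem h4 k4
      | tmul m n =>
        obtain ⟨m0, hm0, m1, hm1, rfl⟩ := gr_decomp (F := F) m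
        obtain ⟨n0, hn0, n1, hn1, rfl⟩ := gr_decomp (F := F) n
        refine ⟨m0 ⊗ₜ n0 + m1 ⊗ₜ n1, add_mem (hs 0 0 _ _ hm0 hn0) (hs 1 1 _ _ hm1 hn1),
          m0 ⊗ₜ n1 + m1 ⊗ₜ n0, add_mem (hs 0 1 _ _ hm0 hn1) (hs 1 0 _ _ hm1 hn0), ?_, ?_, ?_⟩
        · simp only [TensorProduct.add_tmul, TensorProduct.tmul_add]; abel
        · rw [map_add]
          exact add_mem (hg 0 0 _ _ hm0 hn0) (hg 1 1 _ _ hm1 hn1)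
        · rw [map_add]
          exact add_mem (hg 0 1 _ _ hm0 hn1) (hg 1 0 _ _ hm1 hn0)
    have hdisj := Submodule.disjoint_def.1 s.isCompl_grade.disjoint
    intro a t ht
    obtain ⟨t0, h0, t1, h1, rfl, k0, k1⟩ := hd t
    rcases zmod2_cases a with rfl | rfl
    · have : t1 = 0 := hdisj t1 (by simpa using sub_mem ht h0) h1
      rw [this, add_zero]; exact k0
    · have : t0 = 0 := hdisj t0 h0 (by simpa using sub_mem ht h1)
      rw [this, zero_add]; exact k1
  let e1 : ULift.{max u v w x} (M ⊗[F] N) ≃ₗ[F] M ⊗[F] N := ULift.moduleEquiv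
  let e2 : ULift.{max u v w x} T ≃ₗ[F] T := ULift.moduleEquiv
  obtain ⟨h, hh⟩ : ∃ h : T →ₗ[F] M ⊗[F] N, (∀ m n, h (p m n) = m ⊗ₜ n) ∧
      (∀ a, ∀ t ∈ gr F T a, h t ∈ s.grade a) ∧ ∀ t t', h (br F T t t') = 0 := by
    letI := superComap e1
    letI := lsaZero F (ULift.{max u v w x} (M ⊗[F] N))
    obtain ⟨h, hh, -⟩ := hu (ULift.{max u v w x} (M ⊗[F] N))
      ((TensorProduct.mk F M N).compr₂ e1.symm.toLinearMap)
      (by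
        intro a b m n hm hn
        exact hs a b m n hm hn)
      (by intros; rfl)
    refine ⟨e1.toLinearMap ∘ₗ h.toLinearMap, ?_, ?_, ?_⟩
    · intro m n
      simp [hh]
    · intro a t ht
      exact h.map_grade a t ht
    · intro t t'
      have := h.map_bracket t t'
      change e1 (h.toLinearMap _) = 0
      rw [this]; rfl
  obtain ⟨h1, h2, h3⟩ := hh
  have key : g ∘ₗ h = LinearMap.id := by
    letI := superComap e2
    letI := lsaComap e2
    obtain ⟨k, hk, hku⟩ := hu (ULift.{max u v w x} T) (p.compr₂ e2.symm.toLinearMap)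
      (by intro a b m n hm hn; exact hg a b m n hm hn)
      (by
        intro m n m' n'
        apply e2.injective
        exact hb m n m' n')
    let k1 : LieSuperHom F T (ULift.{max u v w x} T) :=
      { toLinearMap := e2.symm.toLinearMap
        map_grade := by intro a t ht; exact ht
        map_bracket := by intro a b; rfl }
    let k2 : LieSuperHom F T (ULift.{max u v w x} T) :=
      { toLinearMap := e2.symm.toLinearMap ∘ₗ g ∘ₗ h
        map_grade := by intro a t ht; exact hgg _ _ (h2 a t ht)
        map_bracket := by
          intro a b
          apply e2.injective
          change g (h _) = br F T (g (h a)) (g (h b))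
          rw [h3, map_zero, hgb] }
    have e12 : k1 = k2 := by
      rw [hku k1 (by intro m n; rfl), hku k2 (by intro m n; simp [k2, h1, g])]
    ext t
    have := congrArg (fun k : LieSuperHom F T (ULift.{max u v w x} T) =>
      e2 (k.toLinearMap t)) e12
    exact this.symm
  refine ⟨LinearEquiv.ofLinearMap h g ?_ key, h1⟩
  apply TensorProduct.ext'
  intro m n
  simp [g, h1]

lemma tsq_equiv {L : Type v} {T : Type w} [AddCommGroup L] [Module F L] [SuperModule F L]
    [LieSuperAlgebra F L] [AddCommGroup T] [Module F T] [SuperModule F T] [LieSuperAlgebra F T]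
    (hL : IsAbelianLSA F L) (p : TensorSqPairing F L T) (hT : IsTensorSquare F L T p) :
    ∃ e : T ≃ₗ[F] L ⊗[F] L, ∀ m n, e (p.pair m n) = m ⊗ₜ n := by
  unfold IsAbelianLSA at hL
  apply core p.pair p.pair_grade
  · intro m n m' n'
    obtain ⟨m0, hm0, m1, hm1, rfl⟩ := gr_decomp (F := F) m
    obtain ⟨n0, hn0, n1, hn1, rfl⟩ := gr_decomp (F := F) n
    have := fun a b x y hx hy => p.rel3 a b x y m' n' hx hy
    simp only [hL, map_zero, smul_zero] at this
    simp [this 0 0 _ _ hm0 hn0, this 0 1 _ _ hm0 hn1, this 1 0 _ _ hm1 hn0,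
      this 1 1 _ _ hm1 hn1]
  · intro T' _ _ _ _ q h1 h2
    exact hT T' ⟨q, h1, by intros; simp [hL], by intros; simp [hL], by intros; simp [hL, h2]⟩

lemma tp_equiv {M : Type v} {N : Type w} {T : Type x}
    [AddCommGroup M] [Module F M] [SuperModule F M] [LieSuperAlgebra F M]
    [AddCommGroup N] [Module F N] [SuperModule F N] [LieSuperAlgebra F N]
    [AddCommGroup T] [Module F T] [SuperModule F T] [LieSuperAlgebra F T]
    (hM : IsAbelianLSA F M) (hN : IsAbelianLSA F N)
    (p : SuperPairing F M N T (trivialAction F M N) (trivialAction F N M))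
    (hT : IsTensorProductLSA F M N T (trivialAction F M N) (trivialAction F N M) p) :
    ∃ e : T ≃ₗ[F] M ⊗[F] N, ∀ m n, e (p.pair m n) = m ⊗ₜ n := by
  unfold IsAbelianLSA at hM hN
  apply core p.pair p.pair_grade
  · intro m n m' n'
    obtain ⟨m0, hm0, m1, hm1, rfl⟩ := gr_decomp (F := F) m
    obtain ⟨n0, hn0, n1, hn1, rfl⟩ := gr_decomp (F := F) n
    have := fun a b x y hx hy => p.rel3 a b x y m' n' hx hy
    simp only [trivialAction, LinearMap.zero_apply, map_zero, smul_zero] at this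
    simp [this 0 0 _ _ hm0 hn0, this 0 1 _ _ hm0 hn1, this 1 0 _ _ hm1 hn0,
      this 1 1 _ _ hm1 hn1]
  · intro T' _ _ _ _ q h1 h2
    exact hT T' ⟨q, h1, by intros; simp [hM, trivialAction], by intros; simp [hN, trivialAction],
      by intros; simp [trivialAction, h2]⟩

lemma two_ne (hchar2 : ringChar F ≠ 2) : (2 : F) ≠ 0 := Ring.two_ne_zero hchar2

/-- the box is the span of the symmetrised pairs -/
lemma box_eq {L : Type v} {T : Type w} [AddCommGroup L] [Module F L] [SuperModule F L]
    [LieSuperAlgebra F L] [AddCommGroup T] [Module F T] [SuperModule F T] [LieSuperAlgebra F T]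
    (hchar2 : ringChar F ≠ 2) (p : TensorSqPairing F L T) (π : L →ₗ[F] L)
    (h0 : ∀ x ∈ gr F L 0, π x = 0) (h1 : ∀ x ∈ gr F L 1, π x = x) :
    squareBox F L T p = Submodule.span F
      {t | ∃ x y, t = p.pair x y + p.pair y x - (2 : F) • p.pair (π y) (π x)} := by
  have h2 := two_ne hchar2
  apply le_antisymm
  · refine Submodule.span_le.2 ?_
    rintro t (⟨a, b, x, y, hx, hy, rfl⟩ | ⟨x, hx, rfl⟩)
    · apply Submodule.subset_span
      refine ⟨x, y, ?_⟩
      rcases zmod2_cases a with rfl | rfl <;> rcases zmod2_cases b with rfl | rfl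
      · simp [sgn, h0 x hx]
      · simp [sgn, h0 x hx]
      · simp [sgn, h0 y hy]
      · simp only [sgn, h1 x hx, h1 y hy, and_self, if_true]
        module
    · have : p.pair x x = (2 : F)⁻¹ •
          (p.pair x x + p.pair x x - (2 : F) • p.pair (π x) (π x)) := by
        rw [h0 x hx, map_zero, smul_zero, sub_zero, ← two_smul F, smul_smul, inv_mul_cancel₀ h2,
          one_smul]
      rw [this]
      exact Submodule.smul_mem _ _ (Submodule.subset_span ⟨x, x, rfl⟩)
  · refine Submodule.span_le.2 ?_
    rintro t ⟨x, y, rfl⟩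
    obtain ⟨x0, hx0, x1, hx1, rfl⟩ := gr_decomp (F := F) x
    obtain ⟨y0, hy0, y1, hy1, rfl⟩ := gr_decomp (F := F) y
    have key : ∀ (a b : ZMod 2) (x y : L), x ∈ gr F L a → y ∈ gr F L b →
        p.pair x y + sgn F a b • p.pair y x ∈ squareBox F L T p := fun a b x y hx hy =>
      Submodule.subset_span (Or.inl ⟨a, b, x, y, hx, hy, rfl⟩)
    have := add_mem (add_mem (key 0 0 x0 y0 hx0 hy0) (key 0 1 x0 y1 hx0 hy1))
      (add_mem (key 1 0 x1 y0 hx1 hy0) (key 1 1 x1 y1 hx1 hy1))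
    refine (congrArg (· ∈ squareBox F L T p) ?_).mpr this
    simp only [sgn, map_add, LinearMap.add_apply, h0 x0 hx0, h0 y0 hy0, h1 x1 hx1, h1 y1 hy1,
      zero_add, and_self, if_true, zero_ne_one, false_and, and_false, if_false]
    module

lemma pair_ext {M : Type v} {N : Type w} {T : Type x} {W : Type y} [AddCommGroup M] [Module F M]
    [AddCommGroup N] [Module F N] [AddCommGroup T] [Module F T] [AddCommGroup W] [Module F W]
    (p : M →ₗ[F] N →ₗ[F] T) (e : T ≃ₗ[F] M ⊗[F] N) (he : ∀ m n, e (p m n) = m ⊗ₜ n)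
    (h k : T →ₗ[F] W) (hk : ∀ x y, h (p x y) = k (p x y)) (t : T) : h t = k t := by
  have : h ∘ₗ e.symm.toLinearMap = k ∘ₗ e.symm.toLinearMap := by
    apply TensorProduct.ext'
    intro x y
    simp [← he, hk]
  simpa using LinearMap.congr_fun this (e t)

end Helpers

theorem stmt_5 (F : Type*) [Field F] (hchar2 : ringChar F ≠ 2) (hchar3 : ringChar F ≠ 3)
    (M : Type*) [AddCommGroup M] [Module F M] [SuperModule F M] [LieSuperAlgebra F M] [FiniteDimensional F M] (hM : IsAbelianLSA F M)
    (N : Type*) [AddCommGroup N] [Module F N] [SuperModule F N] [LieSuperAlgebra F N] [FiniteDimensional F N] (hN : IsAbelianLSA F N)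
    (P : Type*) [AddCommGroup P] [Module F P] [SuperModule F P] [LieSuperAlgebra F P] (hP : IsDirectSumOf F P M N)
    (TP : Type*) [AddCommGroup TP] [Module F TP] [SuperModule F TP] [LieSuperAlgebra F TP]
    (pP : TensorSqPairing F P TP) (hTP : IsTensorSquare F P TP pP)
    (TM : Type*) [AddCommGroup TM] [Module F TM] [SuperModule F TM] [LieSuperAlgebra F TM]
    (pM : TensorSqPairing F M TM) (hTM : IsTensorSquare F M TM pM)
    (TN : Type*) [AddCommGroup TN] [Module F TN] [SuperModule F TN] [LieSuperAlgebra F TN]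
    (pN : TensorSqPairing F N TN) (hTN : IsTensorSquare F N TN pN)
    (TMN : Type*) [AddCommGroup TMN] [Module F TMN] [SuperModule F TMN] [LieSuperAlgebra F TMN]
    (pMN : SuperPairing F M N TMN (trivialAction F M N) (trivialAction F N M))
    (hTMN : IsTensorProductLSA F M N TMN (trivialAction F M N) (trivialAction F N M) pMN) :
    Nonempty ((squareBox F P TP pP) ≃ₗ[F]
      (squareBox F M TM pM × squareBox F N TN pN × TMN)) := by
  obtain ⟨f, g, hbij, hfg, hgf⟩ := hP
  have hPab : IsAbelianLSA F P := by
    intro x y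
    obtain ⟨⟨m, n⟩, rfl⟩ := hbij.2 x
    obtain ⟨⟨m', n'⟩, rfl⟩ := hbij.2 y
    have e1 := f.map_bracket m m'
    have e2 := g.map_bracket n n'
    rw [hM, map_zero] at e1
    rw [hN, map_zero] at e2
    simp only [map_add, LinearMap.add_apply, hfg, hgf, ← e1, ← e2, add_zero]
  obtain ⟨eP, heP⟩ := tsq_equiv hPab pP hTP
  obtain ⟨eM, heM⟩ := tsq_equiv hM pM hTM
  obtain ⟨eN, heN⟩ := tsq_equiv hN pN hTN
  obtain ⟨eC, heC⟩ := tp_equiv hM hN pMN hTMN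
  obtain ⟨πP, P0, P1⟩ := exists_oddProj F P
  obtain ⟨πM, M0, M1⟩ := exists_oddProj F M
  obtain ⟨πN, N0, N1⟩ := exists_oddProj F N
  have hf : ∀ m, πP (f.toLinearMap m) = f.toLinearMap (πM m) := by
    intro m
    obtain ⟨m0, h0, m1, h1, rfl⟩ := gr_decomp (F := F) m
    simp only [map_add, P0 _ (f.map_grade 0 _ h0), P1 _ (f.map_grade 1 _ h1), M0 _ h0, M1 _ h1,
      map_zero]
  have hg : ∀ m, πP (g.toLinearMap m) = g.toLinearMap (πN m) := by
    intro m
    obtain ⟨m0, h0, m1, h1, rfl⟩ := gr_decomp (F := F) m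
    simp only [map_add, P0 _ (g.map_grade 0 _ h0), P1 _ (g.map_grade 1 _ h1), N0 _ h0, N1 _ h1,
      map_zero]
  rw [box_eq hchar2 pP πP P0 P1, box_eq hchar2 pM πM M0 M1, box_eq hchar2 pN πN N0 N1]
  set BP := Submodule.span F
      {t | ∃ x y, t = pP.pair x y + pP.pair y x - (2 : F) • pP.pair (πP y) (πP x)} with hBP
  set BM := Submodule.span F
      {t | ∃ x y, t = pM.pair x y + pM.pair y x - (2 : F) • pM.pair (πM y) (πM x)} with hBM
  set BN := Submodule.span F
      {t | ∃ x y, t = pN.pair x y + pN.pair y x - (2 : F) • pN.pair (πN y) (πN x)} with hBN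
  let E : (M × N) ≃ₗ[F] P := LinearEquiv.ofBijective
    (f.toLinearMap.coprod g.toLinearMap) hbij
  let r : P →ₗ[F] M := LinearMap.fst F M N ∘ₗ E.symm.toLinearMap
  let s : P →ₗ[F] N := LinearMap.snd F M N ∘ₗ E.symm.toLinearMap
  have hEf : ∀ m, E.symm (f.toLinearMap m) = (m, 0) := by
    intro m; rw [LinearEquiv.symm_apply_eq]
    change _ = f.toLinearMap m + g.toLinearMap 0
    rw [map_zero, add_zero]
  have hEg : ∀ n, E.symm (g.toLinearMap n) = (0, n) := by
    intro m; rw [LinearEquiv.symm_apply_eq]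
    change _ = f.toLinearMap 0 + g.toLinearMap m
    rw [map_zero, zero_add]
  have rf : ∀ m, r (f.toLinearMap m) = m := by intro m; simp [r, hEf]
  have rg : ∀ n, r (g.toLinearMap n) = 0 := by intro m; simp [r, hEg]
  have sf : ∀ m, s (f.toLinearMap m) = 0 := by intro m; simp [s, hEf]
  have sg : ∀ n, s (g.toLinearMap n) = n := by intro m; simp [s, hEg]
  clear_value r s
  have hdec : ∀ x, ∃ m n, x = f.toLinearMap m + g.toLinearMap n := by
    intro x
    obtain ⟨⟨m, n⟩, h⟩ := hbij.2 x
    exact ⟨m, n, h.symm⟩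
  have hr : ∀ x, r (πP x) = πM (r x) := by
    intro x
    obtain ⟨m, n, rfl⟩ := hdec x
    simp only [map_add, hf, hg, rf, rg, map_zero]
  have hs : ∀ x, s (πP x) = πN (s x) := by
    intro x
    obtain ⟨m, n, rfl⟩ := hdec x
    simp only [map_add, hf, hg, sf, sg, map_zero]
  have ππM : ∀ x, πM (πM x) = πM x := by
    intro m
    obtain ⟨m0, h0, m1, h1, rfl⟩ := gr_decomp (F := F) m
    simp only [map_add, M0 _ h0, M1 _ h1, zero_add]
  have ππN : ∀ x, πN (πN x) = πN x := by
    intro m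
    obtain ⟨m0, h0, m1, h1, rfl⟩ := gr_decomp (F := F) m
    simp only [map_add, N0 _ h0, N1 _ h1, zero_add]
  -- forward maps
  let A : TP →ₗ[F] TM := TensorProduct.lift (pM.pair.compl₁₂ r r) ∘ₗ eP.toLinearMap
  let B : TP →ₗ[F] TN := TensorProduct.lift (pN.pair.compl₁₂ s s) ∘ₗ eP.toLinearMap
  let C : TP →ₗ[F] TMN := TensorProduct.lift (pMN.pair.compl₁₂ r s) ∘ₗ eP.toLinearMap
  have hA : ∀ x y, A (pP.pair x y) = pM.pair (r x) (r y) := by intro x y; simp [A, heP]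
  have hB : ∀ x y, B (pP.pair x y) = pN.pair (s x) (s y) := by intro x y; simp [B, heP]
  have hC : ∀ x y, C (pP.pair x y) = pMN.pair (r x) (s y) := by intro x y; simp [C, heP]
  -- backward maps
  let A' : TM →ₗ[F] TP :=
    TensorProduct.lift (pP.pair.compl₁₂ f.toLinearMap f.toLinearMap) ∘ₗ eM.toLinearMap
  let B' : TN →ₗ[F] TP :=
    TensorProduct.lift (pP.pair.compl₁₂ g.toLinearMap g.toLinearMap) ∘ₗ eN.toLinearMap
  let C' : TMN →ₗ[F] TP :=
    TensorProduct.lift (pP.pair.compl₁₂ f.toLinearMap g.toLinearMap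
      + pP.pair.flip.compl₁₂ f.toLinearMap g.toLinearMap
      - (2 : F) • pP.pair.flip.compl₁₂ (πP ∘ₗ f.toLinearMap) (πP ∘ₗ g.toLinearMap))
      ∘ₗ eC.toLinearMap
  have hA' : ∀ x y, A' (pM.pair x y) = pP.pair (f.toLinearMap x) (f.toLinearMap y) := by
    intro x y; simp [A', heM]
  have hB' : ∀ x y, B' (pN.pair x y) = pP.pair (g.toLinearMap x) (g.toLinearMap y) := by
    intro x y; simp [B', heN]
  have hC' : ∀ x y, C' (pMN.pair x y) = pP.pair (f.toLinearMap x) (g.toLinearMap y)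
      + pP.pair (g.toLinearMap y) (f.toLinearMap x)
      - (2 : F) • pP.pair (πP (g.toLinearMap y)) (πP (f.toLinearMap x)) := by
    intro x y; simp [C', heC]
  clear_value A B C A' B' C'
  have AA : ∀ t, A (A' t) = t := pair_ext pM.pair eM heM (A ∘ₗ A') LinearMap.id
    (by intro x y; simp [hA, hA', rf])
  have BA : ∀ t, B (A' t) = 0 := pair_ext pM.pair eM heM (B ∘ₗ A') 0
    (by intro x y; simp [hB, hA', sf])
  have CA : ∀ t, C (A' t) = 0 := pair_ext pM.pair eM heM (C ∘ₗ A') 0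
    (by intro x y; simp [hC, hA', sf])
  have AB : ∀ t, A (B' t) = 0 := pair_ext pN.pair eN heN (A ∘ₗ B') 0
    (by intro x y; simp [hA, hB', rg])
  have BB : ∀ t, B (B' t) = t := pair_ext pN.pair eN heN (B ∘ₗ B') LinearMap.id
    (by intro x y; simp [hB, hB', sg])
  have CB : ∀ t, C (B' t) = 0 := pair_ext pN.pair eN heN (C ∘ₗ B') 0
    (by intro x y; simp [hC, hB', rg])
  have AC : ∀ t, A (C' t) = 0 := pair_ext pMN.pair eC heC (A ∘ₗ C') 0
    (by intro x y; simp [hA, hC', hf, hg, rf, rg])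
  have BC : ∀ t, B (C' t) = 0 := pair_ext pMN.pair eC heC (B ∘ₗ C') 0
    (by intro x y; simp [hB, hC', hf, hg, sf, sg])
  have CC : ∀ t, C (C' t) = t := pair_ext pMN.pair eC heC (C ∘ₗ C') LinearMap.id
    (by intro x y; simp [hC, hC', hf, hg, rf, rg, sf, sg])
  have mA : ∀ t ∈ BP, A t ∈ BM := by
    intro t ht
    suffices BP ≤ BM.comap A from this ht
    refine Submodule.span_le.2 ?_
    rintro _ ⟨x, y, rfl⟩
    refine Submodule.subset_span ⟨r x, r y, ?_⟩
    simp only [map_add, map_sub, map_smul, hA, hr]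
  have mB : ∀ t ∈ BP, B t ∈ BN := by
    intro t ht
    suffices BP ≤ BN.comap B from this ht
    refine Submodule.span_le.2 ?_
    rintro _ ⟨x, y, rfl⟩
    refine Submodule.subset_span ⟨s x, s y, ?_⟩
    simp only [map_add, map_sub, map_smul, hB, hs]
  have mA' : ∀ t ∈ BM, A' t ∈ BP := by
    intro t ht
    suffices BM ≤ BP.comap A' from this ht
    refine Submodule.span_le.2 ?_
    rintro _ ⟨x, y, rfl⟩
    refine Submodule.subset_span ⟨f.toLinearMap x, f.toLinearMap y, ?_⟩
    simp only [map_add, map_sub, map_smul, hA', hf]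
  have mB' : ∀ t ∈ BN, B' t ∈ BP := by
    intro t ht
    suffices BN ≤ BP.comap B' from this ht
    refine Submodule.span_le.2 ?_
    rintro _ ⟨x, y, rfl⟩
    refine Submodule.subset_span ⟨g.toLinearMap x, g.toLinearMap y, ?_⟩
    simp only [map_add, map_sub, map_smul, hB', hg]
  have mC' : ∀ t, C' t ∈ BP := by
    intro t
    have := pair_ext pMN.pair eC heC (BP.mkQ ∘ₗ C') 0 (by
      intro x y
      rw [LinearMap.comp_apply, LinearMap.zero_apply, Submodule.mkQ_apply,
        Submodule.Quotient.mk_eq_zero, hC']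
      exact Submodule.subset_span ⟨_, _, rfl⟩) t
    rwa [LinearMap.comp_apply, LinearMap.zero_apply, Submodule.mkQ_apply,
        Submodule.Quotient.mk_eq_zero] at this
  have back : ∀ t ∈ BP, A' (A t) + B' (B t) + C' (C t) = t := by
    intro t ht
    suffices BP ≤ LinearMap.eqLocus (A' ∘ₗ A + B' ∘ₗ B + C' ∘ₗ C) LinearMap.id from this ht
    refine Submodule.span_le.2 ?_
    rintro _ ⟨x, y, rfl⟩
    obtain ⟨m, n, rfl⟩ := hdec x
    obtain ⟨m', n', rfl⟩ := hdec y
    simp only [SetLike.mem_coe, LinearMap.mem_eqLocus, LinearMap.add_apply, LinearMap.comp_apply,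
      LinearMap.id_apply, map_add, map_sub, map_smul, hA, hB, hC, hA', hB', hC', hf, hg, rf, rg,
      sf, sg, map_zero, LinearMap.zero_apply, ππM, ππN, add_zero, zero_add]
    module
  refine ⟨{ toFun := fun t => (⟨A t, mA t t.2⟩, ⟨B t, mB t t.2⟩, C t)
            map_add' := ?_
            map_smul' := ?_
            invFun := fun q => ⟨A' q.1 + B' q.2.1 + C' q.2.2,
              add_mem (add_mem (mA' _ q.1.2) (mB' _ q.2.1.2)) (mC' _)⟩
            left_inv := ?_
            right_inv := ?_ }⟩
  · intro a b
    simp only [Submodule.coe_add, map_add]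
    rfl
  · intro c a
    simp only [Submodule.coe_smul, map_smul, RingHom.id_apply]
    rfl
  · intro t
    exact Subtype.ext (back t t.2)
  · rintro ⟨⟨a, ha⟩, ⟨b, hb⟩, c⟩
    simp only [map_add, AA, BA, CA, AB, BB, CB, AC, BC, CC, add_zero, zero_add]
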